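/- Let 0 < θ < 1 and let φ be continuously differentiable with compact support, sup_x |φ(x)| < 1, φ not identically zero, and κ·∫_{ℝⁿ}|∇φ|² dx < (1−θ)·∫_{ℝⁿ}φ² dx. Then there exists s₀ > 0 such that E(s·φ) < 0 for all s ∈ (0, s₀); in particular the infimum of the energy is strictly less than E(0) = 0. -/

import Mathlib

open MeasureTheory

/-- The Flory–Huggins potential `W(u) = (θ/2)((1−u)ln(1−u) + (1+u)ln(1+u)) + (1/2)(1−u²)`. -/
noncomputable def FH (θ u : ℝ) : ℝ :=
  θ / 2 * ((1 - u) * Real.log (1 - u) + (1 + u) * Real.log (1 + u)) + 1 / 2 * (1 - u ^ 2)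

/-- The renormalized Cahn–Hilliard energy
`E(u) = ∫_{ℝⁿ} ( (κ/2)|∇u(x)|² + W(u(x)) − W(0) ) dx`, with `W(0) = 1/2`,
the integral being with respect to Lebesgue measure on `ℝⁿ`. -/
noncomputable def energy (n : ℕ) (κ θ : ℝ) (u : EuclideanSpace ℝ (Fin n) → ℝ) : ℝ :=
  ∫ x, (κ / 2 * ‖fderiv ℝ u x‖ ^ 2 + (FH θ (u x) - 1 / 2))

theorem log_one_sub_le {x : ℝ} (hx : |x| ≤ 1 / 2) :
    Real.log (1 - x) ≤ -x - x ^ 2 / 2 - x ^ 3 / 3 + 2 * x ^ 4 := by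
  have h := (abs_le.1 (Real.abs_log_sub_add_sum_range_le (show |x| < 1 by linarith) 3)).2
  have hrem : |x| ^ (3 + 1) / (1 - |x|) ≤ 2 * x ^ 4 := by
    rw [div_le_iff₀ (by linarith), show |x| ^ (3 + 1) = x ^ 4 from Even.pow_abs (by decide) x]
    nlinarith [show 0 ≤ x ^ 4 by positivity]
  norm_num [Finset.sum_range_succ] at h hrem
  linarith

theorem FH_sub_half_le {θ u : ℝ} (hθ : 0 ≤ θ) (hu : |u| ≤ 1 / 2) :
    FH θ u - 1 / 2 ≤ -((1 - θ) / 2) * u ^ 2 + 5 * θ / 2 * u ^ 4 := by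
  have h₁ := log_one_sub_le hu
  have h₂ := log_one_sub_le (x := -u) (by rwa [abs_neg])
  rw [sub_neg_eq_add] at h₂
  obtain ⟨hl, hr⟩ := abs_le.1 hu
  have h₃ := mul_le_mul_of_nonneg_left h₁ (show 0 ≤ 1 - u by linarith)
  have h₄ := mul_le_mul_of_nonneg_left h₂ (show 0 ≤ 1 + u by linarith)
  have hent : (1 - u) * Real.log (1 - u) + (1 + u) * Real.log (1 + u) ≤ u ^ 2 + 5 * u ^ 4 := by
    nlinarith [show 0 ≤ u ^ 4 by positivity]
  have := mul_le_mul_of_nonneg_left hent (show 0 ≤ θ / 2 by linarith)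
  unfold FH
  linarith

theorem FH_zero (θ : ℝ) : FH θ 0 = 1 / 2 := by
  simp [FH]

theorem continuous_FH (θ : ℝ) : Continuous (FH θ) := by
  have h₁ : Continuous fun u : ℝ => (1 - u) * Real.log (1 - u) :=
    Real.continuous_mul_log.comp (continuous_const.sub continuous_id)
  have h₂ : Continuous fun u : ℝ => (1 + u) * Real.log (1 + u) :=
    Real.continuous_mul_log.comp (continuous_const.add continuous_id)
  unfold FH
  fun_prop

theorem integral_le_of_le_linear_combination {α : Type*} [MeasurableSpace α] {μ : Measure α}
    {f g w : α → ℝ} (hf : Integrable f μ) (hg : Integrable g μ) (hw : Integrable w μ) {a b c : ℝ}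
    (hle : ∀ x, w x ≤ b * g x) :
    ∫ x, (a * (c * f x) + w x) ∂μ ≤ a * c * (∫ x, f x ∂μ) + b * ∫ x, g x ∂μ := by
  rw [integral_add ((hf.const_mul c).const_mul a) hw, integral_const_mul, integral_const_mul,
    ← mul_assoc, ← integral_const_mul b]
  exact add_le_add_right (integral_mono hw (hg.const_mul b) hle) _

theorem energy_smul_le {n : ℕ} {κ θ s : ℝ} (hθ : 0 ≤ θ) (hs : |s| ≤ 1 / 2)
    {φ : EuclideanSpace ℝ (Fin n) → ℝ} (hφ : ContDiff ℝ 1 φ) (hsupp : HasCompactSupport φ)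
    (hbd : ∀ x, |φ x| ≤ 1) :
    energy n κ θ (fun x => s * φ x) ≤
      s ^ 2 / 2 * (κ * (∫ x, ‖fderiv ℝ φ x‖ ^ 2) - (1 - θ - 5 * θ * s ^ 2) * ∫ x, φ x ^ 2) := by
  have hgradc : Continuous fun x => ‖fderiv ℝ φ x‖ ^ 2 :=
    (hφ.continuous_fderiv one_ne_zero).norm.pow 2
  have hgrads : HasCompactSupport fun x => ‖fderiv ℝ φ x‖ ^ 2 :=
    (hsupp.fderiv (𝕜 := ℝ)).comp_left
      (g := fun L : EuclideanSpace ℝ (Fin n) →L[ℝ] ℝ => ‖L‖ ^ 2)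
      (by rw [norm_zero, zero_pow two_ne_zero])
  have hgrad : Integrable fun x => ‖fderiv ℝ φ x‖ ^ 2 :=
    hgradc.integrable_of_hasCompactSupport hgrads
  have hsqc : Continuous fun x => φ x ^ 2 := hφ.continuous.pow 2
  have hsqs : HasCompactSupport fun x => φ x ^ 2 :=
    hsupp.comp_left (g := fun t : ℝ => t ^ 2) (zero_pow two_ne_zero)
  have hsq : Integrable fun x => φ x ^ 2 := hsqc.integrable_of_hasCompactSupport hsqs
  have hFHc : Continuous fun x => FH θ (s * φ x) - 1 / 2 := by
    have := continuous_FH θ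
    have := hφ.continuous
    fun_prop
  have hFHs : HasCompactSupport fun x => FH θ (s * φ x) - 1 / 2 :=
    hsupp.comp_left (g := fun t : ℝ => FH θ (s * t) - 1 / 2)
      (by simp only [mul_zero, FH_zero, sub_self])
  have hFH : Integrable fun x => FH θ (s * φ x) - 1 / 2 :=
    hFHc.integrable_of_hasCompactSupport hFHs
  have hfd : ∀ x, ‖fderiv ℝ (fun x => s * φ x) x‖ ^ 2 = s ^ 2 * ‖fderiv ℝ φ x‖ ^ 2 := fun x => by
    rw [fderiv_const_mul (hφ.differentiable one_ne_zero x), norm_smul, mul_pow,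
      Real.norm_eq_abs, sq_abs]
  have hpot : ∀ x, FH θ (s * φ x) - 1 / 2 ≤
      -(s ^ 2 / 2 * (1 - θ - 5 * θ * s ^ 2)) * φ x ^ 2 := fun x => by
    have hsφ : |s * φ x| ≤ 1 / 2 := by
      rw [abs_mul]
      nlinarith [hbd x, abs_nonneg s, abs_nonneg (φ x)]
    have hquart : φ x ^ 4 ≤ φ x ^ 2 := by
      nlinarith [(sq_le_one_iff_abs_le_one (φ x)).2 (hbd x), sq_nonneg (φ x)]
    have := mul_le_mul_of_nonneg_left hquart (show 0 ≤ 5 * θ / 2 * s ^ 4 by positivity)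
    have := FH_sub_half_le hθ hsφ
    simp only [mul_pow] at this
    linarith
  have := integral_le_of_le_linear_combination (a := κ / 2) (c := s ^ 2) hgrad hsq hFH hpot
  simp only [energy, hfd]
  linarith

/-- Let `0 < θ < 1` and let `φ : ℝⁿ → ℝ` be `C¹` with compact support, `sup |φ| < 1`,
`φ` not identically zero, and `κ·∫|∇φ|² < (1−θ)·∫φ²`. Then there exists `s₀ > 0` such
that `E(s·φ) < 0` for all `s ∈ (0, s₀)`; in particular the infimum of the energy is
strictly less than `E(0) = 0`. -/
theorem stmt13 (n : ℕ) (hn : 1 ≤ n) (κ θ : ℝ) (hκ : 0 < κ) (hθ0 : 0 < θ) (hθ1 : θ < 1)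
    (φ : EuclideanSpace ℝ (Fin n) → ℝ) (hφ : ContDiff ℝ 1 φ) (hsupp : HasCompactSupport φ)
    (hbd : ∃ M < 1, ∀ x, |φ x| ≤ M)
    (hne : ∃ x, φ x ≠ 0)
    (h : κ * ∫ x, ‖fderiv ℝ φ x‖ ^ 2 < (1 - θ) * ∫ x, (φ x) ^ 2) :
    ∃ s₀ > 0, ∀ s : ℝ, 0 < s → s < s₀ → energy n κ θ (fun x => s * φ x) < 0 := by
  obtain ⟨M, hM, hφM⟩ := hbd
  set B := ∫ x, φ x ^ 2
  set D := (1 - θ) * B - κ * ∫ x, ‖fderiv ℝ φ x‖ ^ 2 with hD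
  have hB : 0 ≤ B := integral_nonneg fun x => sq_nonneg _
  have hDpos : 0 < D := sub_pos.2 h
  refine ⟨min (1 / 2) (D / (5 * B + 1)), by positivity, fun s hs hs₀ => ?_⟩
  obtain ⟨hs₁, hs₂⟩ := lt_min_iff.1 hs₀
  rw [lt_div_iff₀ (by positivity)] at hs₂
  refine (energy_smul_le hθ0.le (by rw [abs_of_pos hs]; exact hs₁.le) hφ hsupp
    fun x => (hφM x).trans hM.le).trans_lt (mul_neg_of_pos_of_neg (by positivity) ?_)
  have hθs : θ * s ^ 2 ≤ s := by nlinarith [sq_nonneg s]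
  have := mul_le_mul_of_nonneg_right hθs hB
  linarith
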